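/- arXiv:2109.12805 — 3 statements merged into one kernel-verified Lean document; each statement's English description precedes it below -/
import Mathlib

section
/- Let A be the adjacency matrix of a divisible design graph with parameters (v, k, λ₁, λ₂, m, n), let S be the v×m characteristic matrix of the canonical partition (S has entry 1 in position ((i,a), j) iff i = j), and let R be an m×m real matrix with A·S = S·R. Then (1) every column of R sums to k, i.e. for all j, Σ_i R(i,j) = k, and (2) trace(R²) = m·k² − (m − 1)·λ₂·v. -/
open Matrix Kronecker

/-- The all-ones matrix. -/
def allOnes (ι : Type*) : Matrix ι ι ℝ := Matrix.of fun _ _ => 1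

/-- `A` is the adjacency matrix of a divisible design graph whose canonical
partition has classes indexed by `cl` and class members indexed by `pt`. -/
def IsDDGAdj {cl pt : Type*} [Fintype cl] [DecidableEq cl] [Fintype pt] [DecidableEq pt]
    (k l1 l2 : ℝ) (A : Matrix (cl × pt) (cl × pt) ℝ) : Prop :=
  A.IsSymm ∧ (∀ x y, A x y = 0 ∨ A x y = 1) ∧ (∀ x, A x x = 0) ∧
  A * A = k • (1 : Matrix (cl × pt) (cl × pt) ℝ)
      + l1 • ((1 : Matrix cl cl ℝ) ⊗ₖ allOnes pt - 1)
      + l2 • (allOnes (cl × pt) - (1 : Matrix cl cl ℝ) ⊗ₖ allOnes pt)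

/-- The characteristic matrix of the canonical partition: entry `((i,a), j)` is `1` iff `i = j`. -/
def charMatrix (m n : ℕ) : Matrix (Fin m × Fin n) (Fin m) ℝ :=
  Matrix.of fun x j => if x.1 = j then 1 else 0

theorem charMatrix_mul_apply {m n : ℕ} (M : Matrix (Fin m) (Fin m) ℝ) (x : Fin m × Fin n)
    (j : Fin m) : (charMatrix m n * M) x j = M x.1 j := by
  simp [Matrix.mul_apply, charMatrix]

theorem mul_charMatrix_apply {m n : ℕ} (M : Matrix (Fin m × Fin n) (Fin m × Fin n) ℝ)
    (x : Fin m × Fin n) (j : Fin m) : (M * charMatrix m n) x j = ∑ b, M x (j, b) := by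
  simp only [Matrix.mul_apply, charMatrix, Matrix.of_apply, Fintype.sum_prod_type]
  rw [Finset.sum_eq_single j]
  · simp
  · intro i _ hi
    simp [hi]
  · simp

/-- A divisible design graph is regular of degree `k`. -/
theorem IsDDGAdj.sum_row {cl pt : Type*} [Fintype cl] [DecidableEq cl] [Fintype pt]
    [DecidableEq pt] {k l1 l2 : ℝ} {A : Matrix (cl × pt) (cl × pt) ℝ}
    (hA : IsDDGAdj k l1 l2 A) (x : cl × pt) : ∑ y, A x y = k := by
  obtain ⟨hsymm, h01, -, hsq⟩ := hA
  have h := congrFun (congrFun hsq x) x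
  rw [Matrix.mul_apply] at h
  simp only [Matrix.add_apply, Matrix.sub_apply, Matrix.smul_apply, kroneckerMap_apply,
    Matrix.one_apply_eq, allOnes, Matrix.of_apply, smul_eq_mul] at h
  calc ∑ y, A x y = ∑ y, A x y * A y x := by
        refine Finset.sum_congr rfl fun y _ => ?_
        rw [hsymm.apply x y]
        rcases h01 x y with h | h <;> simp [h]
    _ = k := by rw [h]; ring

/-- If `R` is a quotient matrix of `A`, then `R * R` has diagonal entries `k + l1 * (n - 1)` and
off-diagonal entries `l2 * n`. -/
theorem IsDDGAdj.quotient_sq_apply {m n : ℕ} (hn : 0 < n) {k l1 l2 : ℝ}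
    {A : Matrix (Fin m × Fin n) (Fin m × Fin n) ℝ} (hA : IsDDGAdj k l1 l2 A)
    {R : Matrix (Fin m) (Fin m) ℝ} (hR : A * charMatrix m n = charMatrix m n * R)
    (i j : Fin m) : (R * R) i j = if i = j then k + l1 * (n - 1) else l2 * n := by
  have hRR : A * A * charMatrix m n = charMatrix m n * (R * R) := by
    rw [Matrix.mul_assoc, hR, ← Matrix.mul_assoc, hR, Matrix.mul_assoc]
  have h := congrFun (congrFun hRR (i, ⟨0, hn⟩)) j
  rw [charMatrix_mul_apply, mul_charMatrix_apply, hA.2.2.2] at h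
  rw [← h]
  by_cases hij : i = j
  · subst hij
    simp [allOnes, Matrix.one_apply, Finset.sum_add_distrib, ← Finset.mul_sum]
  · simp [allOnes, hij, mul_comm]

/-- A quotient matrix of a symmetric matrix for a partition into classes of equal size is
symmetric. -/
theorem isSymm_of_mul_charMatrix {m n : ℕ} (hn : 0 < n)
    {A : Matrix (Fin m × Fin n) (Fin m × Fin n) ℝ} (hA : A.IsSymm)
    {R : Matrix (Fin m) (Fin m) ℝ} (hR : A * charMatrix m n = charMatrix m n * R) :
    R.IsSymm := by
  have hentry (i j : Fin m) : (n : ℝ) * R i j = ∑ a, ∑ b, A (i, a) (j, b) := by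
    simp [← mul_charMatrix_apply, hR, charMatrix_mul_apply]
  have hn' : (n : ℝ) ≠ 0 := by positivity
  refine Matrix.IsSymm.ext fun i j => mul_left_cancel₀ hn' ?_
  rw [hentry, hentry, Finset.sum_comm]
  exact Finset.sum_congr rfl fun _ _ => Finset.sum_congr rfl fun _ _ => hA.apply _ _

/-- The quotient matrix `R` of the canonical partition of a divisible design graph
has all column sums equal to `k`, and `trace(R²) = m·k² − (m − 1)·λ₂·v`. -/
theorem ddg_quotient_matrix_sums_and_trace (m n : ℕ) (hm : 0 < m) (hn : 0 < n)
    (k l1 l2 : ℕ) (A : Matrix (Fin m × Fin n) (Fin m × Fin n) ℝ)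
    (hA : IsDDGAdj (k : ℝ) (l1 : ℝ) (l2 : ℝ) A)
    (R : Matrix (Fin m) (Fin m) ℝ) (hR : A * charMatrix m n = charMatrix m n * R) :
    (∀ j : Fin m, ∑ i : Fin m, R i j = (k : ℝ)) ∧
    (R * R).trace = (m : ℝ) * (k : ℝ) ^ 2 - ((m : ℝ) - 1) * (l2 : ℝ) * ((m * n : ℕ) : ℝ) := by
  have hrow (i : Fin m) : ∑ j, R i j = (k : ℝ) := by
    rw [← hA.sum_row (i, ⟨0, hn⟩), Fintype.sum_prod_type]
    simp [← mul_charMatrix_apply, hR, charMatrix_mul_apply]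
  have hRsymm := isSymm_of_mul_charMatrix hn hA.1 hR
  have hcol (j : Fin m) : ∑ i, R i j = (k : ℝ) := by
    rw [← hrow j]
    exact Finset.sum_congr rfl fun i _ => hRsymm.apply j i
  refine ⟨hcol, ?_⟩
  have hsum : (k : ℝ) + l1 * (n - 1) + (m - 1) * (l2 * n) = k ^ 2 := by
    let i : Fin m := ⟨0, hm⟩
    calc (k : ℝ) + l1 * (n - 1) + (m - 1) * (l2 * n)
        = ∑ j, ((if i = j then (k : ℝ) + l1 * (n - 1) - l2 * n else 0) + l2 * n) := by
          simp [Finset.sum_add_distrib]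
          ring
      _ = ∑ j, (R * R) i j := by
          refine Finset.sum_congr rfl fun j _ => ?_
          rw [hA.quotient_sq_apply hn hR]
          split_ifs <;> ring
      _ = k ^ 2 := by
          simp only [Matrix.mul_apply]
          rw [Finset.sum_comm]
          simp only [← Finset.mul_sum, hrow, ← Finset.sum_mul]
          ring
  have htrace : (R * R).trace = m * ((k : ℝ) + l1 * (n - 1)) := by
    simp [Matrix.trace, hA.quotient_sq_apply hn hR, mul_add]
  rw [htrace, ← hsum]
  push_cast
  ring
end

section
/- Let A' be a symmetric 0-1 m×m matrix with zero diagonal satisfying A'·J_m = k'·J_m and A'² = k'·I_m + λ·A' + (λ+1)·(J_m − I_m − A') (i.e. A' is the adjacency matrix of a strongly regular graph with parameters (m, k', λ, λ+1)). Then the adjacency matrix of the lexicographic product Γ'[K₂], namely A = A' ⊗ J₂ + I_m ⊗ (J₂ − I₂), satisfies A² = (2k'+1)·I + 2k'·(K − I) + (2λ+2)·(J − K) where K = I_m ⊗ J₂; that is, A is the adjacency matrix of a divisible design graph with parameters (2m, 2k' + 1, 2k', 2λ + 2, m, 2). -/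
open Matrix Kronecker

/-- The all-ones matrix squares to its order times itself. -/
theorem allOnes_mul_allOnes (ι : Type*) [Fintype ι] :
    allOnes ι * allOnes ι = (Fintype.card ι : ℝ) • allOnes ι := by
  ext i j
  simp [allOnes, Matrix.mul_apply]

/-- The square of `B ⊗ J₂ + I ⊗ (J₂ − I₂)`. -/
theorem kronecker_allOnes_two_sq {ι : Type*} [Fintype ι] [DecidableEq ι] (B : Matrix ι ι ℝ) :
    (B ⊗ₖ allOnes (Fin 2) + (1 : Matrix ι ι ℝ) ⊗ₖ (allOnes (Fin 2) - 1))
      * (B ⊗ₖ allOnes (Fin 2) + (1 : Matrix ι ι ℝ) ⊗ₖ (allOnes (Fin 2) - 1))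
      = ((2 : ℝ) • (B * B) + (2 : ℝ) • B) ⊗ₖ allOnes (Fin 2) + 1 := by
  have hJJ : allOnes (Fin 2) * allOnes (Fin 2) = allOnes (Fin 2) + allOnes (Fin 2) := by
    simpa [two_smul] using allOnes_mul_allOnes (Fin 2)
  have hJN : allOnes (Fin 2) * (allOnes (Fin 2) - 1) = allOnes (Fin 2) := by
    rw [mul_sub, hJJ, mul_one, add_sub_cancel_right]
  have hNJ : (allOnes (Fin 2) - 1) * allOnes (Fin 2) = allOnes (Fin 2) := by
    rw [sub_mul, hJJ, one_mul, add_sub_cancel_right]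
  have hNN : (allOnes (Fin 2) - 1) * (allOnes (Fin 2) - 1) = 1 := by
    rw [sub_mul, hJN, one_mul, sub_sub_cancel]
  rw [add_mul, mul_add, mul_add]
  simp only [← mul_kronecker_mul, hJJ, hJN, hNJ, hNN, mul_one, one_mul, one_kronecker_one,
    add_kronecker, kronecker_add, two_smul]
  abel

/-- If `A'` is the adjacency matrix of a strongly regular graph with parameters
`(m, k', λ, λ+1)`, then the adjacency matrix `A' ⊗ J₂ + I_m ⊗ (J₂ − I₂)` of the
lexicographic product `Γ'[K₂]` is the adjacency matrix of a divisible design graph with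
parameters `(2m, 2k' + 1, 2k', 2λ + 2, m, 2)`. -/
theorem ddg_construction_lexicographic_K2 (m : ℕ) (hm : 0 < m)
    (k' lam : ℕ)
    (A' : Matrix (Fin m) (Fin m) ℝ)
    (hsym : A'.IsSymm) (h01 : ∀ i j, A' i j = 0 ∨ A' i j = 1) (hdiag : ∀ i, A' i i = 0)
    (hreg : A' * allOnes (Fin m) = (k' : ℝ) • allOnes (Fin m))
    (hsrg : A' * A' = (k' : ℝ) • (1 : Matrix (Fin m) (Fin m) ℝ)
        + (lam : ℝ) • A' + ((lam : ℝ) + 1) • (allOnes (Fin m) - 1 - A')) :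
    IsDDGAdj ((2 * k' + 1 : ℕ) : ℝ) ((2 * k' : ℕ) : ℝ) ((2 * lam + 2 : ℕ) : ℝ)
      (A' ⊗ₖ allOnes (Fin 2)
        + (1 : Matrix (Fin m) (Fin m) ℝ) ⊗ₖ (allOnes (Fin 2) - 1)) := by
  refine ⟨?_, ?_, ?_, ?_⟩
  · ext ⟨i, a⟩ ⟨j, b⟩
    simp [allOnes, hsym.apply i j, Matrix.one_apply, eq_comm]
  · rintro ⟨i, a⟩ ⟨j, b⟩
    by_cases hij : i = j
    · subst hij
      by_cases hab : a = b <;> simp [allOnes, hdiag, hab]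
    · simpa [allOnes, Matrix.one_apply, hij] using h01 i j
  · rintro ⟨i, a⟩
    simp [allOnes, hdiag]
  · rw [kronecker_allOnes_two_sq, hsrg]
    ext ⟨i, a⟩ ⟨j, b⟩
    simp only [allOnes, Matrix.add_apply, Matrix.sub_apply, Matrix.smul_apply,
      kroneckerMap_apply, Matrix.of_apply, smul_eq_mul]
    push_cast
    ring
end

section
/- Let A be the adjacency matrix of a divisible design graph with parameters (v, k, λ₁, λ₂, m, n) (v = m·n, K = I_m ⊗ J_n) whose quotient matrix is a·I_m + b·(J_m − I_m), expressed by the hypothesis A·K = K·A = a·K + b·(J − K) for natural numbers a, b. Let s ≥ 1 and suppose λ₂ = 2b and λ₂ = 2a + (s − 2)·n. Then the matrix B = I_s ⊗ A + (J_s − I_s) ⊗ K, of size s·v (obtained by taking s copies of the graph and joining every vertex to all vertices in the blocks with the same label in all other copies), satisfies B² = (k + (s−1)n)·I + (λ₁ + (s−1)n)·(K' − I) + λ₂·(J' − K'), where K' = I_s ⊗ K = I_{ms} ⊗ J_n and J' is the all-ones matrix of size s·v; that is, B is the adjacency matrix of a divisible design graph with parameters (v·s, k + (s−1)·n, λ₁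 + (s−1)·n, λ₂, m·s, n). -/
open Matrix Kronecker

/-- The block-diagonal matrix `K = I_m ⊗ J_n` with `m` diagonal blocks `J_n`. -/
def Kmat (m n : ℕ) : Matrix (Fin m × Fin n) (Fin m × Fin n) ℝ :=
  (1 : Matrix (Fin m) (Fin m) ℝ) ⊗ₖ allOnes (Fin n)

/-- The matrix `B = I_s ⊗ A + (J_s − I_s) ⊗ K`: `s` copies of the graph with all vertices
of blocks carrying the same label joined across different copies. -/
def copiesJoin (s m n : ℕ) (A : Matrix (Fin m × Fin n) (Fin m × Fin n) ℝ) :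
    Matrix ((Fin s × Fin m) × Fin n) ((Fin s × Fin m) × Fin n) ℝ :=
  Matrix.of fun x y =>
    if x.1.1 = y.1.1 then A (x.1.2, x.2) (y.1.2, y.2) else Kmat m n (x.1.2, x.2) (y.1.2, y.2)

theorem Kmat_apply (m n : ℕ) (x y : Fin m × Fin n) :
    Kmat m n x y = if x.1 = y.1 then 1 else 0 := by
  simp [Kmat, allOnes, Matrix.kroneckerMap_apply, Matrix.one_apply]

theorem Kmat_mul_Kmat (m n : ℕ) : Kmat m n * Kmat m n = (n : ℝ) • Kmat m n := by
  ext x y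
  by_cases h : x.1 = y.1 <;> simp [Matrix.mul_apply, Kmat_apply, Fintype.sum_prod_type, h]

theorem copiesJoin_mul_apply (s m n : ℕ) (A : Matrix (Fin m × Fin n) (Fin m × Fin n) ℝ)
    (i j : Fin s) (p q : Fin m) (u w : Fin n) :
    (copiesJoin s m n A * copiesJoin s m n A) ((i, p), u) ((j, q), w) =
      ∑ t : Fin s, ((if i = t then A else Kmat m n) * (if t = j then A else Kmat m n))
        (p, u) (q, w) := by
  simp only [Matrix.mul_apply, Fintype.sum_prod_type, copiesJoin, Matrix.of_apply]
  refine Finset.sum_congr rfl fun t _ => Finset.sum_congr rfl fun r _ =>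
    Finset.sum_congr rfl fun z _ => ?_
  split_ifs <;> rfl

theorem copiesJoin_mul_apply_same (s m n : ℕ) (A : Matrix (Fin m × Fin n) (Fin m × Fin n) ℝ)
    (i : Fin s) (p q : Fin m) (u w : Fin n) :
    (copiesJoin s m n A * copiesJoin s m n A) ((i, p), u) ((i, q), w) =
      (A * A) (p, u) (q, w) + ((s : ℝ) - 1) * (Kmat m n * Kmat m n) (p, u) (q, w) := by
  rw [copiesJoin_mul_apply]
  have h : ∀ t : Fin s, ((if i = t then A else Kmat m n) * (if t = i then A else Kmat m n))
      (p, u) (q, w) = (Kmat m n * Kmat m n) (p, u) (q, w) +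
        if i = t then (A * A) (p, u) (q, w) - (Kmat m n * Kmat m n) (p, u) (q, w) else 0 := by
    intro t
    by_cases hit : i = t
    · subst hit
      simp
    · simp [hit, Ne.symm hit]
  simp only [h, Finset.sum_add_distrib, Finset.sum_const, Finset.card_univ, Fintype.card_fin,
    nsmul_eq_mul, Finset.sum_ite_eq, Finset.mem_univ, if_true]
  ring

theorem copiesJoin_mul_apply_of_ne (s m n : ℕ) (A : Matrix (Fin m × Fin n) (Fin m × Fin n) ℝ)
    {i j : Fin s} (hij : i ≠ j) (p q : Fin m) (u w : Fin n) :
    (copiesJoin s m n A * copiesJoin s m n A) ((i, p), u) ((j, q), w) =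
      (A * Kmat m n) (p, u) (q, w) + (Kmat m n * A) (p, u) (q, w) +
        ((s : ℝ) - 2) * (Kmat m n * Kmat m n) (p, u) (q, w) := by
  rw [copiesJoin_mul_apply]
  have h : ∀ t : Fin s, ((if i = t then A else Kmat m n) * (if t = j then A else Kmat m n))
      (p, u) (q, w) = (Kmat m n * Kmat m n) (p, u) (q, w) +
        (if i = t then (A * Kmat m n) (p, u) (q, w) - (Kmat m n * Kmat m n) (p, u) (q, w)
          else 0) +
        (if j = t then (Kmat m n * A) (p, u) (q, w) - (Kmat m n * Kmat m n) (p, u) (q, w)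
          else 0) := by
    intro t
    by_cases hit : i = t
    · subst hit
      simp [hij, Ne.symm hij]
    · by_cases hjt : j = t
      · subst hjt
        simp [hij]
      · simp [hit, hjt, Ne.symm hjt]
  simp only [h, Finset.sum_add_distrib, Finset.sum_const, Finset.card_univ, Fintype.card_fin,
    nsmul_eq_mul, Finset.sum_ite_eq, Finset.mem_univ, if_true]
  ring

/-- Taking `s` copies of a divisible design graph whose quotient matrix is
`a·I_m + b·(J_m − I_m)` and joining blocks with the same label yields a divisible design
graph with parameters `(vs, k + (s−1)n, λ₁ + (s−1)n, λ₂, ms, n)`, provided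
`λ₂ = 2b = 2a + (s−2)n`. -/
theorem ddg_construction_copies (m n s : ℕ) (hm : 0 < m) (hn : 0 < n) (hs : 1 ≤ s)
    (k l1 l2 a b : ℕ)
    (A : Matrix (Fin m × Fin n) (Fin m × Fin n) ℝ)
    (hA : IsDDGAdj (k : ℝ) (l1 : ℝ) (l2 : ℝ) A)
    (hAK : A * Kmat m n = (a : ℝ) • Kmat m n + (b : ℝ) • (allOnes (Fin m × Fin n) - Kmat m n))
    (hKA : Kmat m n * A = (a : ℝ) • Kmat m n + (b : ℝ) • (allOnes (Fin m × Fin n) - Kmat m n))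
    (hb : (l2 : ℝ) = 2 * (b : ℝ))
    (ha : (l2 : ℝ) = 2 * (a : ℝ) + ((s : ℝ) - 2) * (n : ℝ)) :
    IsDDGAdj ((k : ℝ) + ((s : ℝ) - 1) * (n : ℝ)) ((l1 : ℝ) + ((s : ℝ) - 1) * (n : ℝ)) (l2 : ℝ)
      (copiesJoin s m n A) := by
  obtain ⟨hsymm, h01, hdiag, hsq⟩ := hA
  refine ⟨?_, ?_, ?_, ?_⟩
  · ext ⟨⟨i, p⟩, u⟩ ⟨⟨j, q⟩, w⟩
    simp only [Matrix.transpose_apply, copiesJoin, Matrix.of_apply, Kmat_apply,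
      hsymm.apply (p, u) (q, w), eq_comm (a := j), eq_comm (a := q)]
  · rintro ⟨⟨i, p⟩, u⟩ ⟨⟨j, q⟩, w⟩
    simp only [copiesJoin, Matrix.of_apply, Kmat_apply]
    split_ifs
    · exact h01 _ _
    · exact Or.inr rfl
    · exact Or.inl rfl
  · rintro ⟨⟨i, p⟩, u⟩
    simp [copiesJoin, hdiag]
  · ext ⟨⟨i, p⟩, u⟩ ⟨⟨j, q⟩, w⟩
    by_cases hij : i = j
    · subst hij
      rw [copiesJoin_mul_apply_same, hsq, Kmat_mul_Kmat]
      simp only [Kmat_apply, Matrix.add_apply, Matrix.sub_apply, Matrix.smul_apply, smul_eq_mul,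
        Matrix.kroneckerMap_apply, Matrix.one_apply, allOnes, Matrix.of_apply, Prod.mk.injEq,
        true_and]
      ring
    · rw [copiesJoin_mul_apply_of_ne s m n A hij, hAK, hKA, Kmat_mul_Kmat]
      simp only [Kmat_apply, Matrix.add_apply, Matrix.sub_apply, Matrix.smul_apply, smul_eq_mul,
        Matrix.kroneckerMap_apply, Matrix.one_apply, allOnes, Matrix.of_apply, Prod.mk.injEq,
        hij, false_and, if_false]
      split_ifs <;> linarith
end
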